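/- arXiv:1611.01079 — 2 statements merged into one kernel-verified Lean document; each statement's English description precedes it below -/
import Mathlib

section
/- Let σ = (σ_1,…,σ_n) be n independent uniformly distributed permutations of [n], let P_σ(i,j) = p_{i,σ_i^{-1}(j)}, and for h ∈ ℕ define the random probability vector π̂(j) = (1/n)Σ_{i=1}^n P_σ^h(i,j). Then for every n and every h ∈ ℕ, the expectation over the environment satisfies 𝔼[ Σ_{j=1}^n π̂(j)² ] ≤ 2(h+1)²/n. -/
open Filter
open scoped BigOperators Classical

/-- The random environment: `n` permutations of `[n]`. -/
abbrev Env (n : ℕ) := Fin n → Equiv.Perm (Fin n)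

/-- The random stochastic matrix `P_σ(i,j) = p_{i, σ_i⁻¹(j)}`. -/
noncomputable def Pmat (n : ℕ) (p : Fin n → Fin n → ℝ) (σ : Env n) (i j : Fin n) : ℝ :=
  p i ((σ i).symm j)

/-- `t`-th matrix power of a transition kernel. -/
noncomputable def matPow (n : ℕ) (P : Fin n → Fin n → ℝ) (t : ℕ) : Fin n → Fin n → ℝ :=
  fun i j => ((Matrix.of P) ^ t) i j

/-- The proxy `π̂(j) = (1/n) ∑_i P_σ^h(i,j)`. -/
noncomputable def piHat (n h : ℕ) (p : Fin n → Fin n → ℝ) (σ : Env n) (j : Fin n) : ℝ :=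
  (1 / (n : ℝ)) * ∑ i : Fin n, matPow n (Pmat n p σ) h i j

section Environment

variable {n : ℕ}

/-- Expectation over the uniform environment. -/
noncomputable def envAvg (F : Env n → ℝ) : ℝ :=
  (∑ σ : Env n, F σ) / (Fintype.card (Env n) : ℝ)

/-- `F` does not depend on the permutations attached to the states in `S`. -/
def IndepOf (S : Finset (Fin n)) (F : Env n → ℝ) : Prop :=
  ∀ i ∈ S, ∀ (τ : Equiv.Perm (Fin n)) (σ : Env n), F (Pi.mulSingle i τ * σ) = F σ

/-- The expectation, under the kernel `P` started at `x`, of `g` evaluated at `S` together with the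
set of visited states, on the event that the first `t` steps visit distinct states
outside of `S`. -/
noncomputable def freshPath (P : Fin n → Fin n → ℝ) (g : Finset (Fin n) → ℝ) :
    ℕ → Finset (Fin n) → Fin n → ℝ
  | 0, S, x => g (insert x S)
  | t + 1, S, x => ∑ z ∈ (insert x S)ᶜ, P x z * freshPath P g t (insert x S) z

lemma card_env_pos : (0 : ℝ) < Fintype.card (Env n) := by
  exact_mod_cast Fintype.card_pos

lemma envAvg_mono {F G : Env n → ℝ} (hFG : ∀ σ, F σ ≤ G σ) : envAvg F ≤ envAvg G := by
  unfold envAvg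
  gcongr with σ _
  exact hFG σ

lemma envAvg_const (c : ℝ) : envAvg (fun _ : Env n => c) = c := by
  unfold envAvg
  rw [Finset.sum_const, Finset.card_univ, nsmul_eq_mul]
  field_simp [card_env_pos.ne']

lemma envAvg_sum {ι : Type*} (s : Finset ι) (F : ι → Env n → ℝ) :
    envAvg (fun σ => ∑ i ∈ s, F i σ) = ∑ i ∈ s, envAvg (F i) := by
  unfold envAvg
  rw [Finset.sum_comm, Finset.sum_div]

lemma envAvg_const_mul (c : ℝ) (F : Env n → ℝ) :
    envAvg (fun σ => c * F σ) = c * envAvg F := by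
  unfold envAvg
  rw [← Finset.mul_sum, mul_div_assoc]

lemma envAvg_const_sub (c : ℝ) (F : Env n → ℝ) :
    envAvg (fun σ => c - F σ) = c - envAvg F := by
  rw [← envAvg_const (n := n) c]
  unfold envAvg
  rw [Finset.sum_sub_distrib, sub_div, Finset.sum_const, Finset.card_univ, nsmul_eq_mul]
  field_simp [card_env_pos.ne']

variable {p : Fin n → Fin n → ℝ}

lemma Pmat_row_sum (hrow : ∀ i, ∑ j, p i j = 1) (σ : Env n) (i : Fin n) :
    ∑ j, Pmat n p σ i j = 1 :=
  (Equiv.sum_comp (σ i).symm (p i)).trans (hrow i)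

/-- A transition out of `x` is uniform and independent of the permutations at other states. -/
lemma envAvg_Pmat_mul (hrow : ∀ i, ∑ j, p i j = 1) {x : Fin n} {F : Env n → ℝ}
    (hF : ∀ (τ : Equiv.Perm (Fin n)) (σ : Env n), F (Pi.mulSingle x τ * σ) = F σ) (z : Fin n) :
    envAvg (fun σ => Pmat n p σ x z * F σ) = 1 / (n : ℝ) * envAvg F := by
  have key : ∀ w : Fin n, envAvg (fun σ => Pmat n p σ x w * F σ)
      = envAvg (fun σ => Pmat n p σ x z * F σ) := by
    intro w
    unfold envAvg
    congr 1
    rw [← Equiv.sum_comp (Equiv.mulLeft (Pi.mulSingle x (Equiv.swap w z) : Env n))]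
    refine Finset.sum_congr rfl fun σ _ => ?_
    rw [Equiv.coe_mulLeft, hF]
    congr 1
    have : ((Pi.mulSingle x (Equiv.swap w z) * σ : Env n) x).symm w = (σ x).symm z := by
      rw [Equiv.symm_apply_eq]
      simp
    simp only [Pmat, this]
  have hsum : ∑ w : Fin n, envAvg (fun σ => Pmat n p σ x w * F σ) = envAvg F := by
    rw [← envAvg_sum]
    congr 1
    funext σ
    rw [← Finset.sum_mul, Pmat_row_sum hrow, one_mul]
  have hn : (n : ℝ) ≠ 0 := by
    have := x.pos
    positivity
  simp only [key, Finset.sum_const, Finset.card_univ, Fintype.card_fin, nsmul_eq_mul] at hsum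
  rw [← hsum]
  field_simp

lemma Pmat_mulSingle_mul {i x : Fin n} (hix : x ≠ i) (τ : Equiv.Perm (Fin n)) (σ : Env n) :
    Pmat n p (Pi.mulSingle i τ * σ) x = Pmat n p σ x := by
  funext j
  simp [Pmat, Pi.mulSingle_eq_of_ne hix]

lemma indepOf_freshPath {g : Env n → Finset (Fin n) → ℝ} (hg : ∀ S, IndepOf S (g · S)) (t : ℕ) :
    ∀ (S : Finset (Fin n)) (x : Fin n), x ∉ S →
      IndepOf S (fun σ => freshPath (Pmat n p σ) (g σ) t S x) := by
  induction t with
  | zero =>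
    intro S x _ i hi τ σ
    exact hg _ i (Finset.mem_insert_of_mem hi) τ σ
  | succ t ih =>
    intro S x hx i hi τ σ
    simp only [freshPath]
    refine Finset.sum_congr rfl fun z hz => ?_
    rw [Pmat_mulSingle_mul (by rintro rfl; exact hx hi)]
    congr 1
    exact ih _ z (Finset.mem_compl.1 hz) i (Finset.mem_insert_of_mem hi) τ σ

/-- Averaging a quantity of expectation at least `1 - c` over the states outside of `S`. -/
lemma one_sub_le_avg_compl {S : Finset (Fin n)} (hn : 0 < n) {c : ℝ} (hc : 0 ≤ c) {f : Fin n → ℝ}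
    (hf : ∀ z ∈ Sᶜ, 1 - c ≤ f z) :
    1 - c - (S.card : ℝ) / n ≤ ∑ z ∈ Sᶜ, 1 / (n : ℝ) * f z := by
  have hn' : (0 : ℝ) < n := by exact_mod_cast hn
  have hle : S.card ≤ n := by simpa using S.card_le_univ
  calc 1 - c - (S.card : ℝ) / n ≤ 1 - c - (S.card : ℝ) / n + c * (S.card / n) := by
        have : 0 ≤ c * ((S.card : ℝ) / n) := by positivity
        linarith
    _ = ∑ _z ∈ Sᶜ, 1 / (n : ℝ) * (1 - c) := by
        rw [Finset.sum_const, Finset.card_compl, Fintype.card_fin, nsmul_eq_mul, Nat.cast_sub hle]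
        field_simp
        ring
    _ ≤ _ := Finset.sum_le_sum fun z hz => by
        have := hf z hz
        gcongr

lemma le_envAvg_freshPath (hrow : ∀ i, ∑ j, p i j = 1) {g : Env n → Finset (Fin n) → ℝ}
    (hg : ∀ S, IndepOf S (g · S)) {c : ℝ} (hc : 0 ≤ c) (t : ℕ) :
    ∀ (S : Finset (Fin n)) (x : Fin n), x ∉ S →
      (∀ T : Finset (Fin n), T.card = S.card + t + 1 → 1 - c ≤ envAvg (g · T)) →
      1 - (c + ∑ i ∈ Finset.range t, ((S.card : ℝ) + 1 + i) / n)
        ≤ envAvg (fun σ => freshPath (Pmat n p σ) (g σ) t S x) := by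
  induction t with
  | zero =>
    intro S x hx hT
    simpa [freshPath] using hT (insert x S) (by simp [Finset.card_insert_of_notMem hx])
  | succ t ih =>
    intro S x hx hT
    have hcard := Finset.card_insert_of_notMem hx
    have hstep := one_sub_le_avg_compl (S := insert x S) x.pos
      (c := c + ∑ i ∈ Finset.range t, (((insert x S).card : ℝ) + 1 + i) / n) (by positivity)
      (f := fun z => envAvg (fun σ => freshPath (Pmat n p σ) (g σ) t (insert x S) z))
      (fun z hz => ih (insert x S) z (Finset.mem_compl.1 hz)
        (fun T h => hT T (by rw [h, hcard]; ring)))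
    simp only [freshPath]
    rw [envAvg_sum]
    refine le_trans (le_of_eq ?_) (hstep.trans (le_of_eq ?_))
    · rw [Finset.sum_range_succ', hcard]
      have : ∀ i : ℕ, ((S.card : ℝ) + 1 + ((i + 1 : ℕ) : ℝ)) / n
          = (((S.card + 1 : ℕ) : ℝ) + 1 + i) / n := by
        intro i
        push_cast
        ring
      simp only [this]
      push_cast
      ring
    · refine Finset.sum_congr rfl fun z hz => (envAvg_Pmat_mul hrow ?_ z).symm
      exact indepOf_freshPath hg t _ z (Finset.mem_compl.1 hz) x (Finset.mem_insert_self x S)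

end Environment

section Kernel

variable {n : ℕ} {P : Fin n → Fin n → ℝ}

lemma matPow_succ_apply (t : ℕ) (i j : Fin n) :
    matPow n P (t + 1) i j = ∑ k, P i k * matPow n P t k j := by
  simp [matPow, pow_succ', Matrix.mul_apply]

lemma sum_matPow_succ_mul (f : Fin n → ℝ) (t : ℕ) (x : Fin n) :
    ∑ k, matPow n P (t + 1) x k * f k = ∑ z, P x z * ∑ k, matPow n P t z k * f k := by
  simp only [matPow_succ_apply, Finset.sum_mul, Finset.mul_sum, mul_assoc]
  exact Finset.sum_comm

lemma matPow_nonneg (hP : ∀ i j, 0 ≤ P i j) (t : ℕ) : ∀ i j, 0 ≤ matPow n P t i j := by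
  induction t with
  | zero =>
    intro i j
    simp only [matPow, pow_zero, Matrix.one_apply]
    split_ifs <;> norm_num
  | succ t ih =>
    intro i j
    rw [matPow_succ_apply]
    exact Finset.sum_nonneg fun k _ => mul_nonneg (hP i k) (ih k j)

lemma matPow_row_sum (hP : ∀ i, ∑ j, P i j = 1) (t : ℕ) :
    ∀ i, ∑ j, matPow n P t i j = 1 := by
  induction t with
  | zero => intro i; simp [matPow, Matrix.one_apply]
  | succ t ih =>
    intro i
    have := sum_matPow_succ_mul (P := P) (fun _ => 1) t i
    simpa [ih, hP] using this

lemma matPow_le_one (hP : ∀ i j, 0 ≤ P i j) (hP1 : ∀ i, ∑ j, P i j = 1) (t : ℕ) (i j : Fin n) :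
    matPow n P t i j ≤ 1 := by
  rw [← matPow_row_sum hP1 t i]
  exact Finset.single_le_sum (fun k _ => matPow_nonneg hP t i k) (Finset.mem_univ j)

lemma freshPath_le_sum_matPow (hP : ∀ i j, 0 ≤ P i j) {g : Finset (Fin n) → ℝ} {f : Fin n → ℝ}
    (hf : ∀ k, 0 ≤ f k) {T : Finset (Fin n)} (hgf : ∀ S, ∀ k ∈ S, k ∉ T → g S ≤ f k) (t : ℕ) :
    ∀ (S : Finset (Fin n)) (x : Fin n), T ⊆ S → x ∉ S →
      freshPath P g t S x ≤ ∑ k, matPow n P t x k * f k := by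
  induction t with
  | zero =>
    intro S x hTS hx
    simpa [freshPath, matPow, Matrix.one_apply] using
      hgf (insert x S) x (Finset.mem_insert_self x S) (fun h => hx (hTS h))
  | succ t ih =>
    intro S x hTS hx
    rw [sum_matPow_succ_mul]
    calc freshPath P g (t + 1) S x
        ≤ ∑ z ∈ (insert x S)ᶜ, P x z * ∑ k, matPow n P t z k * f k :=
          Finset.sum_le_sum fun z hz => mul_le_mul_of_nonneg_left
            (ih _ z (hTS.trans (Finset.subset_insert x S)) (Finset.mem_compl.1 hz)) (hP x z)
      _ ≤ _ := Finset.sum_le_sum_of_subset_of_nonneg (Finset.subset_univ _) fun z _ _ =>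
          mul_nonneg (hP x z)
            (Finset.sum_nonneg fun k _ => mul_nonneg (matPow_nonneg hP t z k) (hf k))

/-- The probability that a chain started from a uniform state visits, in its first `h` steps,
distinct states outside of `S`. -/
noncomputable def freshStart (P : Fin n → Fin n → ℝ) (h : ℕ) (S : Finset (Fin n)) : ℝ :=
  ∑ y ∈ Sᶜ, 1 / (n : ℝ) * freshPath P (fun _ => 1) h S y

lemma freshStart_le (hP : ∀ i j, 0 ≤ P i j) (hP1 : ∀ i, ∑ j, P i j = 1) (h : ℕ)
    {S : Finset (Fin n)} {j : Fin n} (hj : j ∈ S) :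
    freshStart P h S ≤ ∑ y, 1 / (n : ℝ) * (1 - matPow n P h y j) := by
  calc freshStart P h S ≤ ∑ y ∈ Sᶜ, 1 / (n : ℝ) * (1 - matPow n P h y j) := by
        refine Finset.sum_le_sum fun y hy => ?_
        gcongr
        have hle := freshPath_le_sum_matPow hP (g := fun _ => 1)
          (f := fun k => 1 - if k = j then 1 else 0) (T := {j})
          (by intro k; split_ifs <;> norm_num)
          (by
            intro S k _ hk
            simp [Finset.notMem_singleton.1 hk])
          h S y (Finset.singleton_subset_iff.2 hj) (Finset.mem_compl.1 hy)
        simpa [mul_sub, Finset.sum_sub_distrib, matPow_row_sum hP1] using hle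
    _ ≤ _ := Finset.sum_le_sum_of_subset_of_nonneg (Finset.subset_univ _) fun y _ _ =>
        mul_nonneg (by positivity) (sub_nonneg.2 (matPow_le_one hP hP1 h y j))

end Kernel

section Collision

variable {n : ℕ} {p : Fin n → Fin n → ℝ}

lemma le_envAvg_freshStart (hn : 0 < n) (hrow : ∀ i, ∑ j, p i j = 1) (h : ℕ)
    (S : Finset (Fin n)) :
    1 - ∑ i ∈ Finset.range (h + 1), ((S.card : ℝ) + i) / n
      ≤ envAvg (fun σ => freshStart (Pmat n p σ) h S) := by
  simp only [freshStart]
  rw [envAvg_sum]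
  simp only [envAvg_const_mul]
  refine le_trans (le_of_eq ?_) (one_sub_le_avg_compl (S := S) hn
    (c := 0 + ∑ i ∈ Finset.range h, ((S.card : ℝ) + 1 + i) / n) (by positivity)
    (fun z hz => le_envAvg_freshPath hrow (g := fun _ _ => 1) (fun _ _ _ _ _ => rfl) le_rfl h
      S z (Finset.mem_compl.1 hz) (fun T _ => by rw [envAvg_const]; norm_num)))
  rw [Finset.sum_range_succ']
  have : ∀ i : ℕ, ((S.card : ℝ) + ((i + 1 : ℕ) : ℝ)) / n = ((S.card : ℝ) + 1 + i) / n := by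
    intro i
    push_cast
    ring
  simp only [this]
  push_cast
  ring

lemma indepOf_freshStart (h : ℕ) (S : Finset (Fin n)) :
    IndepOf S (fun σ => freshStart (Pmat n p σ) h S) := by
  intro i hi τ σ
  refine Finset.sum_congr rfl fun y hy => ?_
  congr 1
  exact indepOf_freshPath (g := fun _ _ => 1) (fun _ _ _ _ _ => rfl) h S y
    (Finset.mem_compl.1 hy) i hi τ σ

lemma sum_piHat (hn : 0 < n) (hrow : ∀ i, ∑ j, p i j = 1) (h : ℕ) (σ : Env n) :
    ∑ j, piHat n h p σ j = 1 := by
  have hn' : (n : ℝ) ≠ 0 := by positivity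
  simp only [piHat]
  rw [← Finset.mul_sum, Finset.sum_comm]
  simp [matPow_row_sum (Pmat_row_sum hrow σ), hn']

/-- Two chains whose trajectories visit pairwise distinct states do not end at the same state. -/
lemma sum_piHat_sq_le (hn : 0 < n) (hnonneg : ∀ i j, 0 ≤ p i j) (hrow : ∀ i, ∑ j, p i j = 1)
    (h : ℕ) (σ : Env n) :
    ∑ j, (piHat n h p σ j) ^ 2 ≤ 1 - ∑ x, 1 / (n : ℝ) *
      freshPath (Pmat n p σ) (freshStart (Pmat n p σ) h) h ∅ x := by
  have hn' : (n : ℝ) ≠ 0 := by positivity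
  have hP : ∀ i j, 0 ≤ Pmat n p σ i j := fun i j => hnonneg i _
  have hP1 := Pmat_row_sum hrow σ
  have hf : ∀ j, ∑ y, 1 / (n : ℝ) * (1 - matPow n (Pmat n p σ) h y j)
      = 1 - piHat n h p σ j := by
    intro j
    simp only [piHat, mul_sub, Finset.sum_sub_distrib, ← Finset.mul_sum]
    simp [hn']
  have hf0 : ∀ j, 0 ≤ 1 - piHat n h p σ j := fun j => by
    rw [← hf]
    exact Finset.sum_nonneg fun y _ =>
      mul_nonneg (by positivity) (sub_nonneg.2 (matPow_le_one hP hP1 h y j))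
  have hpath : ∀ x, freshPath (Pmat n p σ) (freshStart (Pmat n p σ) h) h ∅ x
      ≤ ∑ k, matPow n (Pmat n p σ) h x k * (1 - piHat n h p σ k) := fun x =>
    freshPath_le_sum_matPow hP hf0 (T := ∅)
      (fun S k hk _ => (freshStart_le hP hP1 h hk).trans_eq (hf k)) h ∅ x
      (Finset.Subset.refl _) (Finset.notMem_empty x)
  have hsum : ∑ x, 1 / (n : ℝ) * freshPath (Pmat n p σ) (freshStart (Pmat n p σ) h) h ∅ x
      ≤ ∑ k, piHat n h p σ k * (1 - piHat n h p σ k) := by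
    refine (Finset.sum_le_sum fun x _ =>
      mul_le_mul_of_nonneg_left (hpath x) (by positivity)).trans_eq ?_
    rw [← Finset.mul_sum, Finset.sum_comm, Finset.mul_sum]
    refine Finset.sum_congr rfl fun k _ => ?_
    rw [← Finset.sum_mul, ← mul_assoc]
    rfl
  have hsplit : ∑ k, piHat n h p σ k * (1 - piHat n h p σ k)
      = 1 - ∑ j, (piHat n h p σ j) ^ 2 := by
    simp only [mul_sub, mul_one, Finset.sum_sub_distrib, sum_piHat hn hrow, sq]
  linarith

lemma sum_range_fresh (h : ℕ) :
    ∑ i ∈ Finset.range (h + 1), ((h : ℝ) + 1 + i) + ∑ i ∈ Finset.range h, ((0 : ℝ) + 1 + i)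
      = (2 * h + 1) * (h + 1) := by
  have hgauss : ∀ m : ℕ, ∑ i ∈ Finset.range m, (i : ℝ) = m * (m - 1) / 2 := by
    intro m
    induction m with
    | zero => simp
    | succ m ih =>
      rw [Finset.sum_range_succ, ih]
      push_cast
      ring
  simp only [Finset.sum_add_distrib, hgauss, Finset.sum_const, Finset.card_range, nsmul_eq_mul]
  push_cast
  ring

end Collision

theorem stmt8
    (n h : ℕ)
    (p : Fin n → Fin n → ℝ)
    (hnonneg : ∀ i j : Fin n, 0 ≤ p i j)
    (hrow : ∀ i : Fin n, ∑ j : Fin n, p i j = 1) :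
    -- `𝔼[∑_j π̂(j)²] ≤ 2(h+1)²/n` (expectation over the uniform environment)
    (∑ σ : Env n, ∑ j : Fin n, (piHat n h p σ j) ^ 2) / (Fintype.card (Env n) : ℝ)
      ≤ 2 * ((h : ℝ) + 1) ^ 2 / n := by
  rcases Nat.eq_zero_or_pos n with rfl | hn
  · simp
  have hn' : (0 : ℝ) < n := by exact_mod_cast hn
  have hfresh : ∀ x : Fin n, 1 - (2 * (h : ℝ) + 1) * (h + 1) / n ≤ envAvg (fun σ =>
      freshPath (Pmat n p σ) (freshStart (Pmat n p σ) h) h ∅ x) := by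
    intro x
    refine le_trans (le_of_eq ?_) (le_envAvg_freshPath hrow
      (g := fun σ => freshStart (Pmat n p σ) h) (indepOf_freshStart h)
      (c := ∑ i ∈ Finset.range (h + 1), ((h : ℝ) + 1 + i) / n) (by positivity) h ∅ x
      (Finset.notMem_empty x) (fun T hT => ?_))
    · rw [← sum_range_fresh, add_div, Finset.sum_div, Finset.sum_div]
      simp
    · have := le_envAvg_freshStart hn hrow h T
      rw [hT] at this
      simpa using this
  have havg := one_sub_le_avg_compl (S := ∅) hn (c := (2 * (h : ℝ) + 1) * (h + 1) / n)
    (by positivity) (fun x _ => hfresh x)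
  have hmain := envAvg_mono (sum_piHat_sq_le hn hnonneg hrow h)
  rw [envAvg_const_sub, envAvg_sum Finset.univ fun x σ => 1 / (n : ℝ) *
    freshPath (Pmat n p σ) (freshStart (Pmat n p σ) h) h ∅ x] at hmain
  simp only [envAvg_const_mul] at hmain
  simp only [Finset.card_empty, Nat.cast_zero, zero_div, sub_zero, Finset.compl_empty] at havg
  change envAvg (fun σ => ∑ j : Fin n, (piHat n h p σ j) ^ 2) ≤ _
  calc envAvg (fun σ => ∑ j : Fin n, (piHat n h p σ j) ^ 2)
      ≤ (2 * (h : ℝ) + 1) * (h + 1) / n := by linarith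
    _ ≤ _ := by
      refine div_le_div_of_nonneg_right ?_ hn'.le
      nlinarith [(Nat.cast_nonneg h : (0 : ℝ) ≤ h)]
end

section
/- Let P be an n×n stochastic matrix, t ∈ ℕ, δ > 0, and let ν be a probability vector on [n]. Let P₀ : [n]×[n] → ℝ satisfy 0 ≤ P₀(i,j) ≤ P^t(i,j) for all i,j and P₀(i,j) ≤ (1+δ)ν(j) + δ/n for all i,j. Then for every i ∈ [n], ‖ν − P^t(i,·)‖_TV ≤ Σ_{j=1}^n (P^t(i,j) − P₀(i,j)) + 2δ. -/
open Filter
open scoped BigOperators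

/-- Total variation distance between two vectors on `[n]`. -/
noncomputable def tv (n : ℕ) (μ ν : Fin n → ℝ) : ℝ :=
  (1 / 2) * ∑ j : Fin n, |μ j - ν j|

theorem sum_matPow_row (n : ℕ) (P : Fin n → Fin n → ℝ)
    (hrow : ∀ i : Fin n, ∑ j : Fin n, P i j = 1) (t : ℕ) (i : Fin n) :
    ∑ j : Fin n, matPow n P t i j = 1 := by
  unfold matPow
  induction t generalizing i with
  | zero => simp [Matrix.one_apply]
  | succ t ih =>
    simp only [pow_succ, Matrix.mul_apply, Matrix.of_apply]
    rw [Finset.sum_comm]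
    simp only [← Finset.mul_sum, hrow, mul_one, ih]

theorem stmt9
    (n t : ℕ)
    (P : Fin n → Fin n → ℝ)
    (hnonneg : ∀ i j : Fin n, 0 ≤ P i j)
    (hrow : ∀ i : Fin n, ∑ j : Fin n, P i j = 1)
    (δ : ℝ) (hδ : 0 < δ)
    (ν : Fin n → ℝ) (hν0 : ∀ j, 0 ≤ ν j) (hν1 : ∑ j : Fin n, ν j = 1)
    (P₀ : Fin n → Fin n → ℝ)
    (hP₀nonneg : ∀ i j : Fin n, 0 ≤ P₀ i j)
    (hP₀le : ∀ i j : Fin n, P₀ i j ≤ matPow n P t i j)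
    (hP₀ν : ∀ i j : Fin n, P₀ i j ≤ (1 + δ) * ν j + δ / n)
    (i : Fin n) :
    tv n ν (fun j => matPow n P t i j) ≤
      (∑ j : Fin n, (matPow n P t i j - P₀ i j)) + 2 * δ := by
  have hn : (n : ℝ) ≠ 0 := Nat.cast_ne_zero.mpr (Fin.pos i).ne'
  have hQ := sum_matPow_row n P hrow t i
  have hpt : ∀ j ∈ Finset.univ, |ν j - matPow n P t i j| ≤
      2 * (matPow n P t i j - P₀ i j) + 2 * (δ * ν j) + 2 * (δ / n)
        + (ν j - matPow n P t i j) := by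
    intro j _
    have h1 := hP₀le i j
    have h2 := hP₀ν i j
    have h3 : 0 ≤ δ * ν j := mul_nonneg hδ.le (hν0 j)
    have h4 : 0 ≤ δ / n := by positivity
    rw [abs_le]
    constructor <;> linarith
  have hsum := Finset.sum_le_sum hpt
  have hδn : ∑ _j : Fin n, 2 * (δ / n) = 2 * δ := by
    simp only [Finset.sum_const, Finset.card_univ, Fintype.card_fin, nsmul_eq_mul]
    field_simp
  rw [Finset.sum_add_distrib, Finset.sum_add_distrib, Finset.sum_add_distrib, hδn,
    ← Finset.mul_sum, ← Finset.mul_sum, ← Finset.mul_sum, Finset.sum_sub_distrib ν, hν1, hQ]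
    at hsum
  unfold tv
  linarith
end
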